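/- Let d ≥ 1 be a natural number and K : ℝ → ℝ satisfy |K(v)| ≤ C_K and |K(v) − K(w)| ≤ L·|v − w| for all v, w ∈ ℝ, where C_K, L ≥ 0. Then for every r with 0 < r ≤ 1, every h > 0, and all a, b ∈ ℝ^d, |∏_{j=1}^d K_h(a_j) − ∏_{j=1}^d K_h(b_j)| ≤ (C_K^{d−1}(2C_K + L)/h^d) · Σ_{j=1}^d (|a_j − b_j|/h)^r. -/

import Mathlib

/-- Telescoping bound for the difference of two products whose factors are bounded by `C`. -/
theorem abs_prod_sub_prod_le {C : ℝ} (hC : 0 ≤ C) (n : ℕ) (f g : Fin (n + 1) → ℝ)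
    (hf : ∀ j, |f j| ≤ C) (hg : ∀ j, |g j| ≤ C) :
    |∏ j, f j - ∏ j, g j| ≤ C ^ n * ∑ j, |f j - g j| := by
  induction n with
  | zero => simp
  | succ n ih =>
    rw [Fin.prod_univ_succ, Fin.prod_univ_succ g, Fin.sum_univ_succ]
    set F := ∏ j : Fin (n + 1), f j.succ with hF
    set G := ∏ j : Fin (n + 1), g j.succ
    set S := ∑ j : Fin (n + 1), |f j.succ - g j.succ|
    have hFC : |F| ≤ C ^ (n + 1) := by
      rw [hF, Finset.abs_prod]
      simpa using Finset.prod_le_prod (s := Finset.univ) (f := fun j : Fin (n + 1) => |f j.succ|)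
        (g := fun _ => C) (fun j _ => abs_nonneg _) fun j _ => hf j.succ
    have hFG : |F - G| ≤ C ^ n * S :=
      ih (fun j => f j.succ) (fun j => g j.succ) (fun j => hf _) fun j => hg _
    calc |f 0 * F - g 0 * G| = |(f 0 - g 0) * F + g 0 * (F - G)| := by ring_nf
      _ ≤ |f 0 - g 0| * |F| + |g 0| * |F - G| := by
        simpa only [abs_mul] using abs_add_le ((f 0 - g 0) * F) (g 0 * (F - G))
      _ ≤ |f 0 - g 0| * C ^ (n + 1) + C * (C ^ n * S) := by
        gcongr
        exact hg 0
      _ = C ^ (n + 1) * (|f 0 - g 0| + S) := by ring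

/-- A bounded Lipschitz function is Hölder continuous of every exponent in `(0, 1]`. -/
theorem abs_sub_le_mul_rpow_of_bounded_of_lipschitz {K : ℝ → ℝ} {C L r : ℝ}
    (hC : 0 ≤ C) (hL : 0 ≤ L) (hbd : ∀ v, |K v| ≤ C)
    (hlip : ∀ v w, |K v - K w| ≤ L * |v - w|) (hr0 : 0 < r) (hr1 : r ≤ 1) (v w : ℝ) :
    |K v - K w| ≤ (2 * C + L) * |v - w| ^ r := by
  rcases le_total |v - w| 1 with h1 | h1
  · have hpow : |v - w| ≤ |v - w| ^ r := by
      rcases (abs_nonneg (v - w)).eq_or_lt with h0 | h0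
      · simp [← h0, hr0.ne']
      · simpa using Real.rpow_le_rpow_of_exponent_ge h0 h1 hr1
    calc |K v - K w| ≤ L * |v - w| := hlip v w
      _ ≤ (2 * C + L) * |v - w| ^ r := by
        gcongr
        linarith
  · calc |K v - K w| ≤ |K v| + |K w| := abs_sub _ _
      _ ≤ (2 * C + L) * 1 := by linarith [hbd v, hbd w]
      _ ≤ (2 * C + L) * |v - w| ^ r := by
        gcongr
        exact Real.one_le_rpow h1 hr0.le

/-- Product-kernel Hölder inequality for rescaled kernels `K_h(v) = (1/h)·K(v/h)`:
if `|K| ≤ C_K` and `K` is `L`-Lipschitz, then for `0 < r ≤ 1` and `h > 0`,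
`|∏_j K_h(a_j) − ∏_j K_h(b_j)| ≤ (C_K^{d−1}(2C_K + L)/h^d) · Σ_j (|a_j − b_j|/h)^r`. -/
theorem product_kernel_holder (d : ℕ) (hd : 1 ≤ d) (K : ℝ → ℝ) (C_K L : ℝ)
    (hCK : 0 ≤ C_K) (hL : 0 ≤ L)
    (hbd : ∀ v : ℝ, |K v| ≤ C_K)
    (hlip : ∀ v w : ℝ, |K v - K w| ≤ L * |v - w|)
    (r : ℝ) (hr0 : 0 < r) (hr1 : r ≤ 1) (h : ℝ) (hh : 0 < h) (a b : Fin d → ℝ) :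
    |(∏ j, (1 / h) * K (a j / h)) - ∏ j, (1 / h) * K (b j / h)|
      ≤ (C_K ^ (d - 1) * (2 * C_K + L) / h ^ d) * ∑ j, (|a j - b j| / h) ^ r := by
  obtain ⟨n, rfl⟩ : ∃ n, d = n + 1 := ⟨d - 1, by omega⟩
  have hterm : ∀ j, |K (a j / h) - K (b j / h)| ≤ (2 * C_K + L) * (|a j - b j| / h) ^ r := by
    intro j
    have hdist : |a j - b j| / h = |a j / h - b j / h| := by
      rw [← sub_div, abs_div, abs_of_pos hh]
    rw [hdist]
    exact abs_sub_le_mul_rpow_of_bounded_of_lipschitz hCK hL hbd hlip hr0 hr1 _ _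
  simp only [Finset.prod_mul_distrib, Finset.prod_const, Finset.card_univ, Fintype.card_fin]
  rw [← mul_sub, abs_mul, abs_of_nonneg (by positivity), Nat.add_sub_cancel]
  calc (1 / h) ^ (n + 1) * |∏ j, K (a j / h) - ∏ j, K (b j / h)|
      ≤ (1 / h) ^ (n + 1) * (C_K ^ n * ∑ j, |K (a j / h) - K (b j / h)|) := by
        gcongr
        exact abs_prod_sub_prod_le hCK n _ _ (fun j => hbd _) fun j => hbd _
    _ ≤ (1 / h) ^ (n + 1) * (C_K ^ n * ∑ j, (2 * C_K + L) * (|a j - b j| / h) ^ r) := by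
        gcongr with j
        exact hterm j
    _ = _ := by
        rw [← Finset.mul_sum, one_div, inv_pow]
        ring
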